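/- Let n ≥ 1 and Ω = {x ∈ ℂ^n : x†x = 1}. Call a set 𝒞 of n×n Hermitian matrices coherent if it is a convex cone containing every positive semidefinite matrix, containing no negative definite matrix, and satisfying: if G + εI ∈ 𝒞 for every ε > 0 then G ∈ 𝒞. Then the map 𝔣 : C ↦ {G Hermitian : the gamble x ↦ x†Gx belongs to C} is a bijection between the family of P-coherent sets of desirable gambles C ⊆ 𝓛_R and the family of coherent subsets of the n×n Hermitian matrices. -/

import Mathlib

open Matrix
open scoped ComplexOrder

noncomputable section

/-- The possibility space: unit vectors in `ℂ^n`. -/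
abbrev SOmega (n : ℕ) := {v : Fin n → ℂ // star v ⬝ᵥ v = 1}

/-- The gamble associated to a matrix `G`: `x ↦ x† G x` (real for Hermitian `G`). -/
def qGamble {n : ℕ} (G : Matrix (Fin n) (Fin n) ℂ) : SOmega n → ℝ :=
  fun x => (star x.1 ⬝ᵥ G *ᵥ x.1).re

/-- `Σ≥`: the gambles whose matrix is positive semidefinite. -/
def SigmaPSD (n : ℕ) : Set (SOmega n → ℝ) :=
  {g | ∃ G : Matrix (Fin n) (Fin n) ℂ, G.PosSemidef ∧ g = qGamble G}

/-- `Σ<`: the gambles whose matrix is negative definite. -/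
def SigmaND (n : ℕ) : Set (SOmega n → ℝ) :=
  {g | ∃ G : Matrix (Fin n) (Fin n) ℂ, (-G).PosDef ∧ g = qGamble G}

/-- `𝓛_R`: the gambles coming from Hermitian matrices. -/
def LRq (n : ℕ) : Set (SOmega n → ℝ) :=
  {g | ∃ G : Matrix (Fin n) (Fin n) ℂ, G.IsHermitian ∧ g = qGamble G}

/-- `posi S`: all finite nonnegative linear combinations of elements of `S`. -/
def posi {n : ℕ} (S : Set (SOmega n → ℝ)) : Set (SOmega n → ℝ) :=
  {h | ∃ (ℓ : ℕ) (lam : Fin ℓ → ℝ) (gs : Fin ℓ → SOmega n → ℝ),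
    (∀ i, 0 ≤ lam i) ∧ (∀ i, gs i ∈ S) ∧ h = fun x => ∑ i, lam i * gs i x}

/-- P-coherence: `C = cl (posi (Σ≥ ∪ 𝒢))` for some `𝒢 ⊆ 𝓛_R`, and `C ∩ Σ< = ∅`. -/
def PCoh (n : ℕ) (C : Set (SOmega n → ℝ)) : Prop :=
  (∃ 𝒢 ⊆ LRq n, C = closure (posi (SigmaPSD n ∪ 𝒢))) ∧ C ∩ SigmaND n = ∅

/-- A coherent set of Hermitian matrix gambles: a convex cone of Hermitian
matrices containing every PSD matrix, containing no negative definite matrix,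
and closed in the sense that `G + εI ∈ 𝒞` for all `ε > 0` implies `G ∈ 𝒞`. -/
def MatCoherent (n : ℕ) (𝒞 : Set (Matrix (Fin n) (Fin n) ℂ)) : Prop :=
  (∀ G ∈ 𝒞, G.IsHermitian) ∧ Convex ℝ 𝒞 ∧
    (∀ c : ℝ, 0 < c → ∀ G ∈ 𝒞, c • G ∈ 𝒞) ∧
    (∀ G : Matrix (Fin n) (Fin n) ℂ, G.PosSemidef → G ∈ 𝒞) ∧
    (∀ G ∈ 𝒞, ¬(-G).PosDef) ∧
    (∀ G : Matrix (Fin n) (Fin n) ℂ, (∀ ε : ℝ, 0 < ε → G + (ε : ℂ) • 1 ∈ 𝒞) → G ∈ 𝒞)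

/-- The map `𝔣 : C ↦ {G Hermitian : (x ↦ x†Gx) ∈ C}`. -/
def fMap (n : ℕ) (C : Set (SOmega n → ℝ)) : Set (Matrix (Fin n) (Fin n) ℂ) :=
  {G | G.IsHermitian ∧ qGamble G ∈ C}

lemma qGamble_add {n : ℕ} (G H : Matrix (Fin n) (Fin n) ℂ) :
    qGamble (G + H) = qGamble G + qGamble H := by
  ext x
  simp [qGamble, add_mulVec, dotProduct_add]

lemma qGamble_smul {n : ℕ} (c : ℝ) (G : Matrix (Fin n) (Fin n) ℂ) :
    qGamble (c • G) = c • qGamble G := by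
  ext x
  simp [qGamble, smul_mulVec, dotProduct_smul]

lemma qGamble_one {n : ℕ} : qGamble (1 : Matrix (Fin n) (Fin n) ℂ) = 1 := by
  ext x
  simp [qGamble, x.2]

lemma qGamble_add_smul_one {n : ℕ} (G : Matrix (Fin n) (Fin n) ℂ) (ε : ℝ) :
    qGamble (G + (ε : ℂ) • 1) = qGamble G + ε • 1 := by
  rw [qGamble_add, ← qGamble_one, ← qGamble_smul]
  rfl

lemma isHermitian_ofReal_smul_one {n : ℕ} (ε : ℝ) :
    ((ε : ℂ) • (1 : Matrix (Fin n) (Fin n) ℂ)).IsHermitian := by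
  simp [IsHermitian, conjTranspose_smul]

/-- Nonnegativity of a gamble on unit vectors makes its matrix positive semidefinite. -/
lemma posSemidef_of_qGamble_nonneg {n : ℕ} {G : Matrix (Fin n) (Fin n) ℂ}
    (hG : G.IsHermitian) (h : ∀ x, 0 ≤ qGamble G x) : G.PosSemidef := by
  rw [hG.posSemidef_iff_eigenvalues_nonneg]
  intro i
  rw [hG.eigenvalues_eq]
  refine h ⟨hG.eigenvectorBasis i, ?_⟩
  rw [dotProduct_comm, ← EuclideanSpace.inner_eq_star_dotProduct, inner_self_eq_norm_sq_to_K,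
    hG.eigenvectorBasis.orthonormal.1 i]
  simp

/-- A Hermitian matrix is determined by its gamble. -/
lemma qGamble_injOn {n : ℕ} :
    Set.InjOn (qGamble (n := n)) {G | G.IsHermitian} := by
  open scoped MatrixOrder in
  intro G hG H hH h
  have key : ∀ A B : Matrix (Fin n) (Fin n) ℂ, A.IsHermitian → B.IsHermitian →
      qGamble A = qGamble B → A ≤ B := fun A B hA hB hAB ↦ by
    refine posSemidef_of_qGamble_nonneg (hB.sub hA) fun x ↦ ?_
    have := congrFun (qGamble_add (B - A) A) x
    rw [sub_add_cancel, ← hAB, Pi.add_apply] at this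
    linarith
  exact le_antisymm (key G H hG hH h) (key H G hH hG h.symm)

lemma norm_apply_le_one {n : ℕ} (x : SOmega n) (i : Fin n) : ‖x.1 i‖ ≤ 1 := by
  have h : ∑ j, ‖x.1 j‖ ^ 2 = 1 := by
    have := x.2
    simp only [dotProduct, Pi.star_apply, RCLike.star_def, Complex.conj_mul'] at this
    exact_mod_cast this
  have := Finset.single_le_sum (f := fun j ↦ ‖x.1 j‖ ^ 2) (fun j _ ↦ sq_nonneg _)
    (Finset.mem_univ i)
  rw [h] at this
  exact (sq_le_one_iff₀ (norm_nonneg _)).1 this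

lemma abs_qGamble_le {n : ℕ} (G : Matrix (Fin n) (Fin n) ℂ) (x : SOmega n) :
    |qGamble G x| ≤ ∑ i, ∑ j, ‖G i j‖ := by
  refine (Complex.abs_re_le_norm _).trans ?_
  refine (norm_sum_le _ _).trans (Finset.sum_le_sum fun i _ ↦ ?_)
  rw [norm_mul, Pi.star_apply, norm_star]
  refine (mul_le_of_le_one_left (norm_nonneg _) (norm_apply_le_one x i)).trans ?_
  refine (norm_sum_le _ fun j ↦ G i j * x.1 j).trans (Finset.sum_le_sum fun j _ ↦ ?_)
  rw [norm_mul]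
  exact mul_le_of_le_one_right (norm_nonneg _) (norm_apply_le_one x j)

/-- The passage from Hermitian matrices to gambles, as a real linear map. -/
def qGambleLinear (n : ℕ) :
    selfAdjoint.submodule ℝ (Matrix (Fin n) (Fin n) ℂ) →ₗ[ℝ] (SOmega n → ℝ) where
  toFun G := qGamble G.1
  map_add' G H := qGamble_add G.1 H.1
  map_smul' c G := qGamble_smul c G.1

lemma isClosedEmbedding_qGambleLinear (n : ℕ) :
    Topology.IsClosedEmbedding (qGambleLinear n) :=
  LinearMap.isClosedEmbedding_of_injective <| LinearMap.ker_eq_bot.2 fun G H h ↦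
    Subtype.ext (qGamble_injOn G.2 H.2 h)

lemma isClosed_LRq (n : ℕ) : IsClosed (LRq n) := by
  convert (isClosedEmbedding_qGambleLinear n).isClosed_range using 1
  ext g
  exact ⟨fun ⟨G, hG, h⟩ ↦ ⟨⟨G, hG⟩, h.symm⟩, fun ⟨G, h⟩ ↦ ⟨G.1, G.2, h.symm⟩⟩

lemma posi_eq_span {n : ℕ} (S : Set (SOmega n → ℝ)) :
    posi S = Submodule.span NNReal S := by
  ext h
  rw [SetLike.mem_coe, Submodule.mem_span_set']
  constructor
  · rintro ⟨ℓ, lam, gs, hlam, hgs, rfl⟩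
    refine ⟨ℓ, fun i ↦ ⟨lam i, hlam i⟩, fun i ↦ ⟨gs i, hgs i⟩, ?_⟩
    ext x
    simp only [Finset.sum_apply]
    rfl
  · rintro ⟨ℓ, lam, gs, rfl⟩
    refine ⟨ℓ, fun i ↦ lam i, fun i ↦ gs i, fun i ↦ (lam i).2, fun i ↦ (gs i).2, ?_⟩
    ext x
    simp only [Finset.sum_apply]
    rfl

/-- The gambles of Hermitian matrices, as a cone. -/
def LRqCone (n : ℕ) : Submodule NNReal (SOmega n → ℝ) :=
  (LinearMap.range (qGambleLinear n)).restrictScalars NNReal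

lemma coe_LRqCone (n : ℕ) : (LRqCone n : Set (SOmega n → ℝ)) = LRq n := by
  ext g
  exact ⟨fun ⟨G, h⟩ ↦ ⟨G.1, G.2, h.symm⟩, fun ⟨G, hG, h⟩ ↦ ⟨⟨G, hG⟩, h.symm⟩⟩

/-- A P-coherent set is a closed convex cone of gambles of Hermitian matrices that contains
every gamble of a positive semidefinite matrix. -/
lemma PCoh.exists_cone {n : ℕ} {C : Set (SOmega n → ℝ)} (h : PCoh n C) :
    ∃ K : Submodule NNReal (SOmega n → ℝ),
      C = K ∧ IsClosed C ∧ SigmaPSD n ⊆ C ∧ C ⊆ LRq n := by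
  obtain ⟨⟨𝒢, h𝒢, hC⟩, -⟩ := h
  rw [posi_eq_span] at hC
  refine ⟨(Submodule.span NNReal (SigmaPSD n ∪ 𝒢)).topologicalClosure, hC,
    hC ▸ isClosed_closure, ?_, ?_⟩
  · rw [hC]
    exact (Set.subset_union_left.trans Submodule.subset_span).trans subset_closure
  · rw [hC]
    refine closure_minimal ?_ (isClosed_LRq n)
    rw [← coe_LRqCone, SetLike.coe_subset_coe, Submodule.span_le, coe_LRqCone]
    exact Set.union_subset (fun g ⟨G, hG, hg⟩ ↦ ⟨G, hG.isHermitian, hg⟩) h𝒢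

lemma PCoh.matCoherent {n : ℕ} {C : Set (SOmega n → ℝ)} (h : PCoh n C) :
    MatCoherent n (fMap n C) := by
  obtain ⟨K, hK, hclosed, hpsd, -⟩ := h.exists_cone
  have hsmul : ∀ (c : ℝ), 0 ≤ c → ∀ G ∈ fMap n C, c • G ∈ fMap n C := fun c hc G hG ↦ by
    refine ⟨hG.1.smul (IsSelfAdjoint.all c), ?_⟩
    have hG' := hG.2
    rw [hK] at hG' ⊢
    rw [qGamble_smul]
    exact K.smul_mem ⟨c, hc⟩ hG'
  have hadd : ∀ G ∈ fMap n C, ∀ H ∈ fMap n C, G + H ∈ fMap n C := fun G hG H hH ↦ by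
    refine ⟨hG.1.add hH.1, ?_⟩
    have hG' := hG.2
    have hH' := hH.2
    rw [hK] at hG' hH' ⊢
    rw [qGamble_add]
    exact K.add_mem hG' hH'
  refine ⟨fun G hG ↦ hG.1, ?_, fun c hc ↦ hsmul c hc.le,
    fun G hG ↦ ⟨hG.isHermitian, hpsd ⟨G, hG, rfl⟩⟩, ?_, ?_⟩
  · intro G hG H hH a b ha hb _
    exact hadd _ (hsmul a ha G hG) _ (hsmul b hb H hH)
  · intro G hG hnd
    have : qGamble G ∈ C ∩ SigmaND n := ⟨hG.2, G, hnd, rfl⟩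
    rw [h.2] at this
    exact this
  · intro G hG
    refine ⟨?_, ?_⟩
    · simpa using (hG 1 one_pos).1.sub (isHermitian_ofReal_smul_one 1)
    · have hlim : Filter.Tendsto (fun ε : ℝ ↦ qGamble G + ε • (1 : SOmega n → ℝ))
          (nhdsWithin 0 (Set.Ioi 0)) (nhds (qGamble G)) := by
        have : Continuous fun ε : ℝ ↦ qGamble G + ε • (1 : SOmega n → ℝ) := by fun_prop
        simpa using (this.tendsto 0).mono_left nhdsWithin_le_nhds
      refine hclosed.mem_of_tendsto hlim ?_
      filter_upwards [self_mem_nhdsWithin] with ε hε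
      rw [← qGamble_add_smul_one]
      exact (hG ε hε).2

lemma PCoh.image_fMap {n : ℕ} {C : Set (SOmega n → ℝ)} (h : PCoh n C) :
    qGamble '' fMap n C = C := by
  obtain ⟨-, -, -, -, hLR⟩ := h.exists_cone
  ext g
  constructor
  · rintro ⟨G, hG, rfl⟩
    exact hG.2
  · intro hg
    obtain ⟨G, hG, rfl⟩ := hLR hg
    exact ⟨G, ⟨hG, hg⟩, rfl⟩

lemma MatCoherent.add_mem {n : ℕ} {𝒞 : Set (Matrix (Fin n) (Fin n) ℂ)} (h : MatCoherent n 𝒞)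
    {G H : Matrix (Fin n) (Fin n) ℂ} (hG : G ∈ 𝒞) (hH : H ∈ 𝒞) : G + H ∈ 𝒞 := by
  have hmid : (1 / 2 : ℝ) • G + (1 / 2 : ℝ) • H ∈ 𝒞 :=
    h.2.1 hG hH (by norm_num) (by norm_num) (by norm_num)
  simpa [smul_smul] using h.2.2.1 2 two_pos _ hmid

/-- The closedness axiom of a coherent set implies that it is topologically closed. -/
lemma MatCoherent.isClosed_preimage {n : ℕ} {𝒞 : Set (Matrix (Fin n) (Fin n) ℂ)}
    (h : MatCoherent n 𝒞) :
    IsClosed ((↑) ⁻¹' 𝒞 : Set (selfAdjoint.submodule ℝ (Matrix (Fin n) (Fin n) ℂ))) := by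
  refine isClosed_of_closure_subset fun G hG ↦ h.2.2.2.2.2 _ fun ε hε ↦ ?_
  have hcont : Continuous fun H : selfAdjoint.submodule ℝ (Matrix (Fin n) (Fin n) ℂ) ↦
      ∑ i, ∑ j, ‖(G.1 - H.1) i j‖ := by
    refine continuous_finsetSum _ fun i _ ↦ continuous_finsetSum _ fun j _ ↦ ?_
    exact ((continuous_const.sub continuous_subtype_val).matrix_elem i j).norm
  have hnear : {H : selfAdjoint.submodule ℝ (Matrix (Fin n) (Fin n) ℂ) |
      ∑ i, ∑ j, ‖(G.1 - H.1) i j‖ < ε} ∈ nhds G :=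
    (isOpen_lt hcont continuous_const).mem_nhds (by simpa using hε)
  obtain ⟨H, hHε, hH⟩ := mem_closure_iff_nhds.1 hG _ hnear
  have hpsd : (G.1 - H.1 + (ε : ℂ) • 1).PosSemidef := by
    refine posSemidef_of_qGamble_nonneg
      ((IsHermitian.sub G.2 H.2).add (isHermitian_ofReal_smul_one ε)) fun x ↦ ?_
    rw [qGamble_add_smul_one]
    have h1 := (abs_le.1 (abs_qGamble_le (G.1 - H.1) x)).1
    have h2 : ∑ i, ∑ j, ‖(G.1 - H.1) i j‖ < ε := hHε
    simp only [Pi.add_apply, Pi.smul_apply, Pi.one_apply, smul_eq_mul, mul_one]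
    linarith
  convert h.add_mem hH (h.2.2.2.1 _ hpsd) using 1
  abel

lemma MatCoherent.isClosed_image {n : ℕ} {𝒞 : Set (Matrix (Fin n) (Fin n) ℂ)}
    (h : MatCoherent n 𝒞) : IsClosed (qGamble '' 𝒞) := by
  convert (isClosedEmbedding_qGambleLinear n).isClosedMap _ h.isClosed_preimage using 1
  ext g
  exact ⟨fun ⟨G, hG, hg⟩ ↦ ⟨⟨G, h.1 G hG⟩, hG, hg⟩, fun ⟨G, hG, hg⟩ ↦ ⟨G.1, hG, hg⟩⟩

/-- The gambles of a coherent set of matrices, as a cone. -/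
def MatCoherent.cone {n : ℕ} {𝒞 : Set (Matrix (Fin n) (Fin n) ℂ)} (h : MatCoherent n 𝒞) :
    Submodule NNReal (SOmega n → ℝ) where
  carrier := qGamble '' 𝒞
  zero_mem' := ⟨0, h.2.2.2.1 0 .zero, by simpa using qGamble_smul 0 (0 : Matrix _ _ ℂ)⟩
  add_mem' := by
    rintro _ _ ⟨G, hG, rfl⟩ ⟨H, hH, rfl⟩
    exact ⟨G + H, h.add_mem hG hH, qGamble_add G H⟩
  smul_mem' := by
    rintro c _ ⟨G, hG, rfl⟩
    refine ⟨(c : ℝ) • G, ?_, qGamble_smul c G⟩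
    rcases eq_or_ne c 0 with rfl | hc
    · simpa using h.2.2.2.1 0 .zero
    · exact h.2.2.1 c (NNReal.coe_pos.2 (pos_iff_ne_zero.2 hc)) G hG

lemma MatCoherent.pCoh_image {n : ℕ} {𝒞 : Set (Matrix (Fin n) (Fin n) ℂ)}
    (h : MatCoherent n 𝒞) : PCoh n (qGamble '' 𝒞) := by
  refine ⟨⟨qGamble '' 𝒞, ?_, ?_⟩, ?_⟩
  · rintro _ ⟨G, hG, rfl⟩
    exact ⟨G, h.1 G hG, rfl⟩
  · rw [posi_eq_span]
    refine (Set.subset_union_right.trans Submodule.subset_span).trans subset_closure |>.antisymm ?_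
    refine closure_minimal ?_ h.isClosed_image
    refine (Submodule.span_le (p := h.cone)).2 (Set.union_subset ?_ subset_rfl)
    rintro _ ⟨G, hG, rfl⟩
    exact ⟨G, h.2.2.2.1 G hG, rfl⟩
  · refine Set.eq_empty_of_forall_notMem ?_
    rintro _ ⟨⟨G, hG, rfl⟩, H, hH, hGH⟩
    have hH' : H.IsHermitian := by simpa using hH.isHermitian.neg
    obtain rfl := qGamble_injOn (h.1 G hG) hH' hGH
    exact h.2.2.2.2.1 G hG hH

lemma MatCoherent.fMap_image {n : ℕ} {𝒞 : Set (Matrix (Fin n) (Fin n) ℂ)}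
    (h : MatCoherent n 𝒞) : fMap n (qGamble '' 𝒞) = 𝒞 := by
  ext G
  constructor
  · rintro ⟨hG, H, hH, hHG⟩
    rwa [← qGamble_injOn (h.1 H hH) hG hHG]
  · exact fun hG ↦ ⟨h.1 G hG, G, hG, rfl⟩

/-- `𝔣` is a bijection between P-coherent sets of desirable gambles
and coherent sets of Hermitian matrices. -/
theorem stmt13 (n : ℕ) (hn : 1 ≤ n) :
    (∀ C : Set (SOmega n → ℝ), PCoh n C → MatCoherent n (fMap n C))
    ∧ (∀ C C' : Set (SOmega n → ℝ), PCoh n C → PCoh n C' →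
        fMap n C = fMap n C' → C = C')
    ∧ (∀ 𝒞 : Set (Matrix (Fin n) (Fin n) ℂ), MatCoherent n 𝒞 →
        ∃ C : Set (SOmega n → ℝ), PCoh n C ∧ fMap n C = 𝒞) := by
  refine ⟨fun C hC ↦ hC.matCoherent, fun C C' hC hC' h ↦ ?_,
    fun 𝒞 h𝒞 ↦ ⟨_, h𝒞.pCoh_image, h𝒞.fMap_image⟩⟩
  rw [← hC.image_fMap, ← hC'.image_fMap, h]
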